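/- Let l ∈ ℕ, l ≥ 1, let c = 4l, and let d ≥ 2. Then for every K₀ ∈ ℕ there exists a hypergraph H with disc(H, c) ≥ K₀ and disc(Δ^d H, c) ≥ (1/6) · disc(H, c)². -/

import Mathlib

/-- The Stirling numbers of the second kind: `stirling2 d k` is the number of
partitions of a `d`-element set into `k` nonempty parts. -/
def stirling2 : ℕ → ℕ → ℕ
  | 0, 0 => 1
  | 0, _ + 1 => 0
  | _ + 1, 0 => 0
  | d + 1, k + 1 => (k + 1) * stirling2 d (k + 1) + stirling2 d k

/-- The discrepancy of a `c`-coloring `χ` of the hypergraph with edge set `H`. -/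
noncomputable def discCol {V : Type} (H : Finset (Finset V)) (c : ℕ) (χ : V → Fin c) : ℝ :=
  ⨆ E ∈ H, ⨆ i : Fin c, |((E.filter fun v => χ v = i).card : ℝ) - (E.card : ℝ) / (c : ℝ)|

/-- The `c`-color discrepancy of the hypergraph with edge set `H`. -/
noncomputable def disc {V : Type} (H : Finset (Finset V)) (c : ℕ) : ℝ :=
  ⨅ χ : V → Fin c, discCol H c χ

/-- The `d`-fold symmetric product of a hypergraph: edge set `{E^d : E ∈ H}`
on the vertex set `V^d`. -/
def symProd {V : Type} [DecidableEq V] (H : Finset (Finset V)) (d : ℕ) :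
    Finset (Finset (Fin d → V)) :=
  H.image fun E => Fintype.piFinset fun _ : Fin d => E

open Finset

/-- Ramsey's theorem for `k`-element subsets of a linear order, for finitely many colors. -/
theorem exists_subset_card_eq_homogeneous {κ : Type*} [Fintype κ] [Nonempty κ]
    (k m : ℕ) :
    ∃ N : ℕ, ∀ {α : Type} [LinearOrder α] (f : Finset α → κ) (S : Finset α), N ≤ #S →
      ∃ T ⊆ S, #T = m ∧ ∃ a, ∀ D ⊆ T, #D = k → f D = a := by
  classical
  induction k generalizing m with
  | zero =>
    refine ⟨m, fun {α} _ f S hS => ?_⟩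
    obtain ⟨T, hT, hm⟩ := exists_subset_card_eq hS
    refine ⟨T, hT, hm, f ∅, fun D _ hD => ?_⟩
    rw [card_eq_zero.mp hD]
  | succ k ih =>
    have key : ∀ r : ℕ, ∃ N : ℕ, ∀ {α : Type} [LinearOrder α] (f : Finset α → κ) (S : Finset α), N ≤ #S →
        ∃ T ⊆ S, #T = r ∧ ∃ g : α → κ, ∀ x ∈ T, ∀ D ⊆ T, (∀ y ∈ D, x < y) → #D = k →
          f (insert x D) = g x := by
      intro r
      induction r with
      | zero =>
        exact ⟨0, fun _ _ _ => ⟨∅, empty_subset _, rfl, fun _ => Classical.arbitrary κ, by simp⟩⟩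
      | succ r ihr =>
        obtain ⟨M, hM⟩ := ihr
        obtain ⟨N, hN⟩ := ih M
        refine ⟨N + 1, fun {α} _ f S hS => ?_⟩
        have hne : S.Nonempty := card_pos.mp (by omega)
        set x := S.min' hne
        have hxS : x ∈ S := S.min'_mem hne
        obtain ⟨S', hS', hcard, a, ha⟩ := hN (fun D => f (insert x D)) (S.erase x)
          (by rw [card_erase_of_mem hxS]; omega)
        obtain ⟨T, hT, hTr, g, hg⟩ := hM f S' hcard.ge
        have hlt : ∀ y ∈ T, x < y := fun y hy => by
          have h := hS' (hT hy)
          exact lt_of_le_of_ne (S.min'_le _ (mem_of_mem_erase h)) (ne_of_mem_erase h).symm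
        have hxT : x ∉ T := fun h => (hlt x h).false
        refine ⟨insert x T, ?_, by rw [card_insert_of_notMem hxT, hTr], Function.update g x a, ?_⟩
        · exact insert_subset hxS ((hT.trans hS').trans (erase_subset _ _))
        · intro z hz D hD hzD hDk
          have hDT : D ⊆ T := fun y hy => by
            rcases mem_insert.mp (hD hy) with rfl | h
            · rcases mem_insert.mp hz with h' | h'
              · exact absurd (hzD _ hy) (by rw [h']; exact lt_irrefl _)
              · exact absurd (hzD _ hy) (hlt _ h').not_gt
            · exact h
          rcases mem_insert.mp hz with rfl | hz
          · rw [Function.update_self]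
            exact ha D (hDT.trans hT) hDk
          · rw [Function.update_of_ne (hlt z hz).ne']
            exact hg z hz D hDT hzD hDk
    obtain ⟨N, hN⟩ := key (Fintype.card κ * m)
    refine ⟨N, fun {α} _ f S hS => ?_⟩
    obtain ⟨T, hT, hTr, g, hg⟩ := hN f S hS
    obtain ⟨a, -, ha⟩ := exists_le_card_fiber_of_mul_le_card_of_maps_to
      (s := T) (t := (univ : Finset κ)) (f := g) (n := m) (fun _ _ => mem_univ _) univ_nonempty
      (by rw [hTr, card_univ])
    obtain ⟨U, hU, hUm⟩ := exists_subset_card_eq ha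
    refine ⟨U, (hU.trans (filter_subset _ _)).trans hT, hUm, a, fun D hD hDk => ?_⟩
    have hne : D.Nonempty := card_pos.mp (by omega)
    have hx := D.min'_mem hne
    have hUT : U ⊆ T := hU.trans (filter_subset _ _)
    rw [← insert_erase hx, hg _ (hUT (hD hx)) _ ((erase_subset _ _).trans (hD.trans hUT))
      (fun y hy => D.min'_lt_of_mem_erase_min' hne hy) (by rw [card_erase_of_mem hx]; omega)]
    exact (mem_filter.mp (hU (hD hx))).2

/-- Simultaneous Ramsey theorem: on some large subset the color of a set of at most `d` elements
depends only on its cardinality. -/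
theorem exists_subset_forall_card_le_homogeneous {κ : Type*} [Fintype κ] [Nonempty κ]
    (d m : ℕ) :
    ∃ N : ℕ, ∀ {α : Type} [LinearOrder α] (f : Finset α → κ) (S : Finset α), N ≤ #S →
      ∃ T ⊆ S, #T = m ∧ ∃ a : ℕ → κ, ∀ D ⊆ T, #D < d → f D = a #D := by
  induction d with
  | zero =>
    refine ⟨m, fun {α} _ f S hS => ?_⟩
    obtain ⟨T, hT, hm⟩ := exists_subset_card_eq hS
    exact ⟨T, hT, hm, fun _ => Classical.arbitrary κ, by simp⟩
  | succ d ih =>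
    obtain ⟨M, hM⟩ := ih
    obtain ⟨N, hN⟩ := exists_subset_card_eq_homogeneous (κ := κ) d M
    refine ⟨N, fun {α} _ f S hS => ?_⟩
    obtain ⟨S', hS', hcard, b, hb⟩ := hN f S hS
    obtain ⟨T, hT, hm, a, ha⟩ := hM f S' hcard.ge
    refine ⟨T, hT.trans hS', hm, Function.update a d b, fun D hD hDd => ?_⟩
    rcases (Nat.lt_succ_iff.mp hDd).lt_or_eq with h | h
    · rw [Function.update_of_ne h.ne, ha D hD h]
    · rw [h, Function.update_self, hb D (hD.trans hT) h]

/-- The number of tuples of color `i` whose set of entries is exactly `R`. -/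
def imageCount {V κ : Type*} [Fintype V] [DecidableEq V] [DecidableEq κ] {d : ℕ}
    (χ : (Fin d → V) → κ) (R : Finset V) (i : κ) : ℕ :=
  #{x : Fin d → V | univ.image x = R ∧ χ x = i}

section imageCount

variable {V κ : Type*} [Fintype V] [DecidableEq V] [DecidableEq κ] {d : ℕ}

theorem imageCount_eq_zero (χ : (Fin d → V) → κ) {R : Finset V} (h : d < #R) (i : κ) :
    imageCount χ R i = 0 := by
  rw [imageCount, card_eq_zero, filter_eq_empty_iff]
  rintro x - ⟨rfl, -⟩
  exact absurd (card_image_le (s := univ) (f := x)) (by simpa using h)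

theorem imageCount_le (χ : (Fin d → V) → κ) {R : Finset V} (h : #R ≤ d) (i : κ) :
    imageCount χ R i ≤ d ^ d := by
  calc imageCount χ R i ≤ #(Fintype.piFinset fun _ : Fin d => R) := by
        refine card_le_card fun x hx => ?_
        simp only [mem_filter, mem_univ, true_and] at hx
        rw [Fintype.mem_piFinset]
        exact fun j => hx.1 ▸ mem_image_of_mem x (mem_univ j)
    _ = #R ^ d := by simp
    _ ≤ d ^ d := Nat.pow_le_pow_left h d

theorem card_filter_piFinset (χ : (Fin d → V) → κ) (E : Finset V) (i : κ) :
    #{x ∈ Fintype.piFinset fun _ : Fin d => E | χ x = i} =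
      ∑ R ∈ E.powerset, imageCount χ R i := by
  rw [card_eq_sum_card_fiberwise (f := fun x => univ.image x) (t := E.powerset)]
  · refine sum_congr rfl fun R hR => congrArg card ?_
    rw [mem_powerset] at hR
    ext x
    simp only [mem_filter, Fintype.mem_piFinset, mem_univ, true_and]
    constructor
    · rintro ⟨⟨-, h⟩, h'⟩
      exact ⟨h', h⟩
    · rintro ⟨h, h'⟩
      exact ⟨⟨fun j => hR (h ▸ mem_image_of_mem x (mem_univ j)), h'⟩, h⟩
  · intro x hx
    simp only [coe_filter, Fintype.mem_piFinset, Set.mem_ofPred_eq] at hx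
    simp only [coe_powerset, Set.mem_preimage, Set.mem_powerset_iff, coe_subset]
    exact image_subset_iff.mpr fun j _ => hx.1 j

theorem card_filter_piFinset_eq_sum_choose (χ : (Fin d → V) → κ) {T E : Finset V}
    {a : ℕ → κ → ℕ} (ha : ∀ R ⊆ T, ∀ i, imageCount χ R i = a #R i) (hE : E ⊆ T) (i : κ) :
    #{x ∈ Fintype.piFinset fun _ : Fin d => E | χ x = i} =
      ∑ k ∈ range (#E + 1), (#E).choose k * a k i := by
  rw [card_filter_piFinset]
  simp_rw [← smul_eq_mul]
  rw [← sum_powerset_apply_card (fun k => a k i)]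
  exact sum_congr rfl fun R hR => ha R ((mem_powerset.mp hR).trans hE) i

theorem card_pow_eq_sum_choose [Fintype κ] (χ : (Fin d → V) → κ) {T E : Finset V}
    {a : ℕ → κ → ℕ} (ha : ∀ R ⊆ T, ∀ i, imageCount χ R i = a #R i) (hE : E ⊆ T) :
    #E ^ d = ∑ k ∈ range (#E + 1), (#E).choose k * ∑ i, a k i := by
  have h : #(Fintype.piFinset fun _ : Fin d => E) = #E ^ d := by simp
  rw [← h, card_eq_sum_card_fiberwise (f := χ) (t := univ) (fun _ _ => mem_coe.mpr (mem_univ _))]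
  simp_rw [card_filter_piFinset_eq_sum_choose χ ha hE, mul_sum]
  exact sum_comm

/-- The number of surjections onto a two-element set is `2 ^ d - 2`. -/
theorem sum_two_add_two [Fintype κ] (χ : (Fin d → V) → κ) (hd : d ≠ 0) {T : Finset V}
    {a : ℕ → κ → ℕ} (ha : ∀ R ⊆ T, ∀ i, imageCount χ R i = a #R i) (hT : 2 ≤ #T) :
    ∑ i, a 2 i + 2 = 2 ^ d := by
  have h (m : ℕ) (hm : m ≤ 2) :
      m ^ d = ∑ k ∈ range (m + 1), m.choose k * ∑ i, a k i := by
    obtain ⟨E, hE, rfl⟩ := exists_subset_card_eq (hm.trans hT)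
    exact card_pow_eq_sum_choose χ ha hE
  have h0 := h 0 (by norm_num)
  have h1 := h 1 (by norm_num)
  have h2 := h 2 (by norm_num)
  simp [sum_range_succ, hd] at h0 h1 h2
  simp [← h0] at h1 h2
  omega

end imageCount

/-- If `∑ a` is not divisible by the number `c` of terms, then some `a i` differs from the mean
by at least `1 / 2`. -/
theorem exists_card_le_two_mul_abs {c : ℕ} (a : Fin c → ℤ) (h : ¬ (c : ℤ) ∣ ∑ i, a i) :
    ∃ i, (c : ℤ) ≤ 2 * |c * a i - ∑ j, a j| := by
  by_contra! hlt
  apply h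
  have hc : 0 < c := by
    rcases Nat.eq_zero_or_pos c with rfl | hc
    · simp at h
    · exact hc
  let i₀ : Fin c := ⟨0, hc⟩
  have heq : ∀ i, a i = a i₀ := by
    intro i
    have h2 := hlt i
    have h3 := hlt i₀
    rw [← abs_two, ← abs_mul, abs_lt] at h2 h3
    have hc' : (0 : ℤ) < c := by exact_mod_cast hc
    have h4 : (c : ℤ) * (a i - a i₀) < c * 1 := by linarith [h2.2, h3.1]
    have h5 : (c : ℤ) * (-1) < c * (a i - a i₀) := by linarith [h2.1, h3.2]
    have h6 := lt_of_mul_lt_mul_left h4 hc'.le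
    have h7 := lt_of_mul_lt_mul_left h5 hc'.le
    omega
  rw [sum_congr rfl fun i _ => heq i]
  simp

theorem pow_le_two_pow_mul_factorial_mul_choose {n k d : ℕ} (hk : k ≤ d) (hn : 2 * d ≤ n) :
    n ^ k ≤ 2 ^ d * d.factorial * n.choose k := by
  have h1 : (n + 1 - k) ^ k ≤ n.descFactorial k := Nat.pow_sub_le_descFactorial n k
  rw [Nat.descFactorial_eq_factorial_mul_choose] at h1
  calc n ^ k ≤ (2 * (n + 1 - k)) ^ k := Nat.pow_le_pow_left (by omega) k
    _ = 2 ^ k * (n + 1 - k) ^ k := mul_pow ..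
    _ ≤ 2 ^ d * (d.factorial * n.choose k) := by
        refine Nat.mul_le_mul (Nat.pow_le_pow_right (by norm_num) hk) (h1.trans ?_)
        exact Nat.mul_le_mul_right _ (Nat.factorial_le hk)
    _ = _ := by ring

/-- An integer combination of binomial coefficients with bounded coefficients whose quadratic
coefficient is at least `c / 2` grows at least like `c * n ^ 2 / 6`. -/
theorem exists_forall_sq_le_abs_sum_choose (c B d : ℕ) (hc : 1 ≤ c) :
    ∃ n₀ : ℕ, ∀ n ≥ n₀, ∀ b : ℕ → ℤ, (∀ k, |b k| ≤ B) → (c : ℤ) ≤ 2 * |b 2| →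
      ∀ J, 2 ≤ J → J ≤ d → (c : ℤ) * n ^ 2 ≤ 6 * |∑ k ∈ range (J + 1), (n.choose k : ℤ) * b k| := by
  set A := 2 ^ d * d.factorial
  have hApos : 1 ≤ A := Nat.one_le_iff_ne_zero.mpr (by positivity)
  refine ⟨2 * d + A * (B * (d + 1) + c) + 24 * B + 24, fun n hn b hB h2 J hJ => ?_⟩
  have hn1 : 1 ≤ n := by omega
  induction J, hJ using Nat.le_induction with
  | base =>
    intro _
    have hch : 2 * (n.choose 2 : ℤ) = n * (n - 1) := by
      have h := Nat.choose_two_right n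
      have h' : 2 * n.choose 2 = n * (n - 1) := by
        rw [h]; exact Nat.mul_div_cancel' (Nat.even_mul_pred_self n).two_dvd
      zify [hn1] at h'
      exact h'
    have h24 : 24 * (B : ℤ) + 24 ≤ n := by
      have : 24 * B + 24 ≤ n := by omega
      exact_mod_cast this
    have hc' : (1 : ℤ) ≤ c := by exact_mod_cast hc
    have hb0 := hB 0
    have hb1 := hB 1
    have hn0 : (0 : ℤ) ≤ n := by positivity
    have hmul : |(n.choose 2 : ℤ) * b 2| = n.choose 2 * |b 2| := by
      rw [abs_mul, Nat.abs_cast]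
    have hmul1 : |(n : ℤ) * b 1| ≤ n * B := by
      rw [abs_mul, Nat.abs_cast]
      exact mul_le_mul_of_nonneg_left hb1 hn0
    have hsum : ∑ k ∈ range (2 + 1), (n.choose k : ℤ) * b k
        = n.choose 2 * b 2 + (n * b 1 + b 0) := by
      simp [sum_range_succ]; ring
    rw [hsum]
    have htri := abs_sub_abs_le_abs_add ((n.choose 2 : ℤ) * b 2) (n * b 1 + b 0)
    have htri2 := abs_add_le ((n : ℤ) * b 1) (b 0)
    have hlow : (c : ℤ) * (n * (n - 1)) ≤ 4 * (n.choose 2 * |b 2|) := by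
      have : (n.choose 2 : ℤ) * c ≤ n.choose 2 * (2 * |b 2|) :=
        mul_le_mul_of_nonneg_left h2 (by positivity)
      rw [← hch]; linarith
    rw [hmul] at htri
    have hBn : 0 ≤ (B : ℤ) := by positivity
    have hfin : 2 * ((c : ℤ) * n ^ 2) ≤ 3 * (c * (n * (n - 1))) - 12 * (n * B + B) := by
      have e1 : (n : ℤ) * (24 * B + 24) ≤ n * n := mul_le_mul_of_nonneg_left h24 hn0
      have e2 : 0 ≤ ((c : ℤ) - 1) * (n * n - 3 * n) := by
        apply mul_nonneg (by linarith); nlinarith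
      have e3 : (B : ℤ) ≤ n * B := by nlinarith
      nlinarith
    linarith
  | succ J hJ ih =>
    intro hJd
    rw [sum_range_succ]
    by_cases hz : b (J + 1) = 0
    · simpa [hz] using ih (by omega)
    · have hone : 1 ≤ |b (J + 1)| := Int.one_le_abs hz
      have hch : ((n : ℤ) ^ (J + 1)) ≤ A * n.choose (J + 1) := by
        exact_mod_cast pow_le_two_pow_mul_factorial_mul_choose hJd (by omega)
      have hlow : |∑ k ∈ range (J + 1), (n.choose k : ℤ) * b k| ≤ (d + 1) * (n ^ J * B) := by
        calc _ ≤ ∑ k ∈ range (J + 1), |(n.choose k : ℤ) * b k| := abs_sum_le_sum_abs _ _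
          _ ≤ ∑ k ∈ range (J + 1), (n : ℤ) ^ J * B := by
            refine sum_le_sum fun k hk => ?_
            rw [abs_mul, Nat.abs_cast]
            refine mul_le_mul ?_ (hB k) (abs_nonneg _) (by positivity)
            have : n.choose k ≤ n ^ J := (Nat.choose_le_pow n k).trans
              (Nat.pow_le_pow_right hn1 (Nat.lt_succ_iff.mp (mem_range.mp hk)))
            exact_mod_cast this
          _ = (J + 1) * (n ^ J * B) := by simp
          _ ≤ (d + 1) * (n ^ J * B) := by
            refine mul_le_mul_of_nonneg_right ?_ (by positivity)
            have : J ≤ d := by omega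
            exact_mod_cast Nat.succ_le_succ this
      have htop : (n.choose (J + 1) : ℤ) ≤ |(n.choose (J + 1) : ℤ) * b (J + 1)| := by
        rw [abs_mul, Nat.abs_cast]
        exact le_mul_of_one_le_right (by positivity) hone
      have hn' : (A : ℤ) * (B * (d + 1) + c) ≤ n := by
        have : A * (B * (d + 1) + c) ≤ n := by omega
        exact_mod_cast this
      have hApos' : (0 : ℤ) < A := by exact_mod_cast hApos
      have hbig : (n : ℤ) ^ J * (B * (d + 1) + c) ≤ n.choose (J + 1) := by
        refine le_of_mul_le_mul_left (le_trans ?_ hch) hApos'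
        calc (A : ℤ) * (n ^ J * (B * (d + 1) + c)) = n ^ J * (A * (B * (d + 1) + c)) := by ring
          _ ≤ n ^ J * n := mul_le_mul_of_nonneg_left hn' (by positivity)
          _ = n ^ (J + 1) := (pow_succ _ _).symm
      have hsq : (c : ℤ) * n ^ 2 ≤ c * n ^ J := by
        refine mul_le_mul_of_nonneg_left ?_ (by positivity)
        exact_mod_cast Nat.pow_le_pow_right hn1 hJ
      have htri := abs_sub_abs_le_abs_add ((n.choose (J + 1) : ℤ) * b (J + 1))
        (∑ k ∈ range (J + 1), (n.choose k : ℤ) * b k)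
      rw [add_comm ((n.choose (J + 1) : ℤ) * b (J + 1))] at htri
      have hnn : 0 ≤ (c : ℤ) * n ^ 2 := by positivity
      linarith

theorem discCol_nonneg {V : Type} (H : Finset (Finset V)) (c : ℕ) (χ : V → Fin c) : 0 ≤ discCol H c χ :=
  Real.iSup_nonneg fun _ => Real.iSup_nonneg fun _ => Real.iSup_nonneg fun _ => abs_nonneg _

section disc

variable {V : Type} [Finite V]

theorem abs_sub_le_discCol {H : Finset (Finset V)} {c : ℕ} (χ : V → Fin c) {E : Finset V}
    (hE : E ∈ H) (i : Fin c) :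
    |((E.filter fun v => χ v = i).card : ℝ) - (E.card : ℝ) / (c : ℝ)| ≤ discCol H c χ := by
  unfold discCol
  refine le_ciSup_of_le (Set.finite_range _).bddAbove E ?_
  refine le_ciSup_of_le (Set.finite_range _).bddAbove hE ?_
  exact le_ciSup (f := fun i => |((E.filter fun v => χ v = i).card : ℝ) - (E.card : ℝ) / (c : ℝ)|)
    (Set.finite_range _).bddAbove i

theorem disc_le_of_card_le {H : Finset (Finset V)} {c n : ℕ} (hc : 1 ≤ c)
    (h : ∀ E ∈ H, #E ≤ n) : disc H c ≤ n := by
  have hc' : (1 : ℝ) ≤ c := by exact_mod_cast hc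
  refine (ciInf_le (Set.finite_range _).bddBelow fun _ => ⟨0, hc⟩).trans ?_
  refine Real.iSup_le (fun E => Real.iSup_le (fun hE => Real.iSup_le (fun i => ?_) ?_) ?_) ?_
  · have h1 : (#{v ∈ E | (⟨0, hc⟩ : Fin c) = i} : ℝ) ≤ #E := by
      exact_mod_cast card_filter_le _ _
    have h2 : (#E : ℝ) ≤ n := by exact_mod_cast h E hE
    have h3 : (#E : ℝ) / c ≤ #E := div_le_self (by positivity) hc'
    have h4 : 0 ≤ (#E : ℝ) / c := by positivity
    have h5 : 0 ≤ (#{v ∈ E | (⟨0, hc⟩ : Fin c) = i} : ℝ) := by positivity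
    rw [abs_le]
    constructor <;> linarith
  all_goals positivity

theorem half_le_disc_powersetCard [Fintype V] {c n : ℕ} (hc : 2 ≤ c)
    (hV : c * n ≤ Fintype.card V) : (n : ℝ) / 2 ≤ disc (powersetCard n (univ : Finset V)) c := by
  have : Nonempty (Fin c) := ⟨⟨0, by omega⟩⟩
  refine le_ciInf fun χ => ?_
  obtain ⟨i, -, hi⟩ := exists_le_card_fiber_of_mul_le_card_of_maps_to
    (s := (univ : Finset V)) (t := (univ : Finset (Fin c))) (f := χ) (n := n)
    (fun _ _ => mem_univ _) univ_nonempty (by simpa using hV)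
  obtain ⟨E, hE, hEn⟩ := exists_subset_card_eq hi
  refine le_trans ?_ (abs_sub_le_discCol χ (mem_powersetCard.mpr ⟨subset_univ E, hEn⟩) i)
  rw [filter_true_of_mem fun v hv => (mem_filter.mp (hE hv)).2, hEn]
  have hc' : (2 : ℝ) ≤ c := by exact_mod_cast hc
  have : (n : ℝ) / c ≤ n / 2 := by gcongr
  exact le_trans (by linarith) (le_abs_self _)

end disc

/-- A large enough complete `n`-uniform hypergraph has symmetric product of discrepancy at least
`n ^ 2 / 6`. -/
theorem exists_sq_div_six_le_disc_symProd (l d : ℕ) (hl : 1 ≤ l) (hd : 2 ≤ d) :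
    ∃ n₀ : ℕ, ∀ n ≥ n₀, ∃ N₀ : ℕ, ∀ N ≥ N₀,
      (n : ℝ) ^ 2 / 6 ≤ disc (symProd (powersetCard n (univ : Finset (Fin N))) d) (4 * l) := by
  set c := 4 * l with hc
  have hc1 : 1 ≤ c := by omega
  have hcR : (0 : ℝ) < c := by exact_mod_cast hc1
  have : Nonempty (Fin c) := ⟨⟨0, hc1⟩⟩
  obtain ⟨n₀, hn₀⟩ := exists_forall_sq_le_abs_sum_choose c (c * d ^ d) d hc1
  refine ⟨n₀ + d, fun n hn => ?_⟩
  obtain ⟨N₀, hN₀⟩ := exists_subset_forall_card_le_homogeneous (κ := Fin c → Fin (d ^ d + 1))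
    (d + 1) n
  refine ⟨N₀, fun N hN => le_ciInf fun χ => ?_⟩
  obtain ⟨T, -, hTn, a₀, ha₀⟩ := hN₀ (fun R i => Fin.ofNat (d ^ d + 1) (imageCount χ R i))
    (univ : Finset (Fin N)) (by simpa using hN)
  let a : ℕ → Fin c → ℕ := fun k i => if k ≤ d then a₀ k i else 0
  have ha_le : ∀ k i, a k i ≤ d ^ d := fun k i => by
    simp only [a]
    split_ifs
    · exact Nat.lt_succ_iff.mp (a₀ k i).isLt
    · exact Nat.zero_le _
  have ha : ∀ R ⊆ T, ∀ i, imageCount χ R i = a #R i := fun R hR i => by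
    by_cases h : #R ≤ d
    · simp only [a, if_pos h, ← ha₀ R hR (Nat.lt_succ_iff.mpr h)]
      exact (Nat.mod_eq_of_lt (Nat.lt_succ_iff.mpr (imageCount_le χ h i))).symm
    · simp only [a, if_neg h]
      exact imageCount_eq_zero χ (not_le.mp h) i
  have hsum2 := sum_two_add_two χ (by omega) ha (by omega)
  obtain ⟨i, hi⟩ := exists_card_le_two_mul_abs (fun j => (a 2 j : ℤ)) (by
    intro hdvd
    have h4 : (4 : ℤ) ∣ ∑ j, (a 2 j : ℤ) := (Dvd.intro (l : ℤ) (by rw [hc]; simp)).trans hdvd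
    have h4' : 4 ∣ ∑ j, a 2 j := by exact_mod_cast h4
    have h4'' : 4 ∣ 2 ^ d := pow_dvd_pow 2 hd
    omega)
  let b : ℕ → ℤ := fun k => c * a k i - ∑ j, (a k j : ℤ)
  have hb : ∀ k, |b k| ≤ (c * d ^ d : ℕ) := fun k => by
    have h1 : c * a k i ≤ c * d ^ d := Nat.mul_le_mul_left _ (ha_le k i)
    have h2 : ∑ j, a k j ≤ c * d ^ d := by
      simpa using sum_le_card_nsmul univ (a k) (d ^ d) fun j _ => ha_le k j
    have h1' : (c : ℤ) * a k i ≤ (c * d ^ d : ℕ) := by exact_mod_cast h1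
    have h2' : ∑ j, (a k j : ℤ) ≤ (c * d ^ d : ℕ) := by exact_mod_cast h2
    have h3 : 0 ≤ (c : ℤ) * a k i := by positivity
    have h4 : 0 ≤ ∑ j, (a k j : ℤ) := by positivity
    simp only [b]
    rw [abs_le]
    constructor <;> linarith
  have hmain := hn₀ n (by omega) b hb hi d hd le_rfl
  have hext : ∑ k ∈ range (d + 1), (n.choose k : ℤ) * b k
      = ∑ k ∈ range (n + 1), (n.choose k : ℤ) * b k := by
    refine sum_subset (range_subset_range.mpr (by omega)) fun k _ hk => ?_
    have hk' : ¬ k ≤ d := by simpa using hk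
    simp [b, a, hk']
  set P : Finset (Fin d → Fin N) := Fintype.piFinset fun _ => T
  have hcount := card_filter_piFinset_eq_sum_choose χ ha subset_rfl i
  have htotal := card_pow_eq_sum_choose χ ha subset_rfl
  rw [hTn] at hcount htotal
  have hcardP : #P = n ^ d := by simp [P, hTn]
  have hval : ∑ k ∈ range (n + 1), (n.choose k : ℤ) * b k
      = c * (#{x ∈ P | χ x = i} : ℤ) - #P := by
    rw [hcount, hcardP, htotal]
    push_cast
    rw [mul_sum, ← sum_sub_distrib]
    exact sum_congr rfl fun k _ => by simp only [b]; ring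
  rw [hext, hval] at hmain
  have hmain' : (c : ℝ) * n ^ 2 ≤ 6 * |c * (#{x ∈ P | χ x = i} : ℝ) - #P| := by
    exact_mod_cast hmain
  have hPmem : P ∈ symProd (powersetCard n (univ : Finset (Fin N))) d :=
    mem_image.mpr ⟨T, mem_powersetCard.mpr ⟨subset_univ T, hTn⟩, rfl⟩
  refine le_trans ?_ (abs_sub_le_discCol χ hPmem i)
  have hfac : (c : ℝ) * (#{x ∈ P | χ x = i} : ℝ) - #P
      = c * ((#{x ∈ P | χ x = i} : ℝ) - #P / c) := by
    field_simp
  rw [hfac, abs_mul, abs_of_pos hcR] at hmain'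
  have := le_of_mul_le_mul_left
    (show (c : ℝ) * n ^ 2 ≤ c * (6 * |(#{x ∈ P | χ x = i} : ℝ) - #P / c|) by linarith) hcR
  linarith

/-- For `c = 4l` and any `d ≥ 2`, there are hypergraphs of arbitrarily large
discrepancy with `disc(Δ^d H, c) ≥ disc(H,c)² / 6`. -/
theorem stmt4 (l d : ℕ) (hl : 1 ≤ l) (hd : 2 ≤ d) :
    ∀ K₀ : ℕ, ∃ (n : ℕ) (H : Finset (Finset (Fin n))),
      (K₀ : ℝ) ≤ disc H (4 * l) ∧
      (1 / 6 : ℝ) * disc H (4 * l) ^ 2 ≤ disc (symProd H d) (4 * l) := by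
  intro K₀
  obtain ⟨n₀, hn₀⟩ := exists_sq_div_six_le_disc_symProd l d hl hd
  set n := max n₀ (2 * K₀)
  obtain ⟨N₀, hN₀⟩ := hn₀ n (le_max_left _ _)
  refine ⟨max N₀ (4 * l * n), powersetCard n univ, ?_, ?_⟩
  · refine le_trans ?_ (half_le_disc_powersetCard (by omega) (by simp))
    have : ((2 * K₀ : ℕ) : ℝ) ≤ n := by exact_mod_cast le_max_right _ _
    push_cast at this
    linarith
  · refine le_trans ?_ (hN₀ _ (le_max_left _ _))
    have h0 : 0 ≤ disc (powersetCard n (univ : Finset (Fin (max N₀ (4 * l * n))))) (4 * l) :=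
      Real.iInf_nonneg fun χ => discCol_nonneg _ _ χ
    have h1 : disc (powersetCard n (univ : Finset (Fin (max N₀ (4 * l * n))))) (4 * l) ≤ n :=
      disc_le_of_card_le (by omega) fun E hE => (mem_powersetCard.mp hE).2.le
    have h2 := pow_le_pow_left₀ h0 h1 2
    linarith
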